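/- arXiv:2601.06872 — 2 statements merged into one kernel-verified Lean document; each statement's English description precedes it below -/
import Mathlib

section
/- Let k ⊆ K be a field extension of characteristic 0 such that k is relatively algebraically closed in K. Fix an algebraic closure K̄ of K, let k̄ be the algebraic closure of k inside K̄, and let K·k̄ ⊆ K̄ be the compositum of K and k̄. Then K·k̄ is a Galois extension of K, and the restriction map Gal(K·k̄/K) → Gal(k̄/k), σ ↦ σ|_{k̄}, is a group isomorphism. -/
namespace IntermediateField

variable (F K L E : Type*) [Field F] [Field K] [Field L] [Field E] [Algebra F K] [Algebra F L]
  [Algebra F E] [Algebra K E] [Algebra L E] [IsScalarTower F K E] [IsScalarTower F L E]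

theorem algebraMap_restrictRestrictAlgEquivMapHom_apply [Normal F K] (φ : Gal(E/L)) (x : K) :
    algebraMap K E (restrictRestrictAlgEquivMapHom F K L E φ x) = φ (algebraMap K E x) :=
  AlgEquiv.restrictNormal_commutes (MulSemiringAction.toAlgAut Gal(E/L) F E φ) K x

theorem continuous_restrictRestrictAlgEquivMapHom [Normal F K] :
    Continuous (restrictRestrictAlgEquivMapHom F K L E) := by
  refine continuous_of_continuousAt_one _ fun s hs ↦ ?_
  rw [map_one, krullTopology_mem_nhds_one_iff] at hs
  obtain ⟨N, hN, hNs⟩ := hs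
  obtain ⟨S, rfl⟩ := (essFiniteType_iff (K := N)).mp inferInstance
  have hfin : FiniteDimensional L (adjoin L (algebraMap K E '' (S : Set K))) := by
    refine finiteDimensional_adjoin ?_
    rintro _ ⟨x, -, rfl⟩
    exact ((Normal.isIntegral (F := F) inferInstance x).algebraMap (B := E)).tower_top
  rw [Filter.mem_map, krullTopology_mem_nhds_one_iff]
  refine ⟨_, hfin, fun φ hφ ↦ hNs ?_⟩
  rw [SetLike.mem_coe, mem_fixingSubgroup_iff] at hφ
  rw [SetLike.mem_coe, ← Subgroup.zpowers_le, ← le_iff_le, adjoin_le_iff]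
  intro x hx
  rw [SetLike.mem_coe, mem_fixedField_iff]
  suffices h : Subgroup.zpowers (restrictRestrictAlgEquivMapHom F K L E φ) ≤
      MulAction.stabilizer Gal(K/F) x from fun f hf ↦ h hf
  rw [Subgroup.zpowers_le, MulAction.mem_stabilizer_iff]
  apply (algebraMap K E).injective
  rw [AlgEquiv.smul_def, algebraMap_restrictRestrictAlgEquivMapHom_apply]
  exact hφ _ (subset_adjoin _ _ ⟨x, hx, rfl⟩)

/-- The infinite-degree version of `restrictRestrictAlgEquivMapHom_surjective`. -/
theorem restrictRestrictAlgEquivMapHom_surjective_of_isGalois [IsGalois F K] [IsGalois L E]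
    (h : ∀ x : K, algebraMap K E x ∈ (algebraMap L E).range → x ∈ (algebraMap F K).range) :
    Function.Surjective (restrictRestrictAlgEquivMapHom F K L E) := by
  let H : ClosedSubgroup Gal(K/F) := ⟨(restrictRestrictAlgEquivMapHom F K L E).range,
    (isCompact_range (continuous_restrictRestrictAlgEquivMapHom F K L E)).isClosed⟩
  suffices hH : fixedField H.1 = ⊥ by
    have := InfiniteGalois.fixingSubgroup_fixedField H
    rw [hH, fixingSubgroup_bot] at this
    exact MonoidHom.range_eq_top.mp this.symm
  refine eq_bot_iff.mpr fun x hx ↦ mem_bot.mpr (h x ?_)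
  refine (InfiniteGalois.mem_range_algebraMap_iff_fixed _).mpr fun φ ↦ ?_
  rw [← algebraMap_restrictRestrictAlgEquivMapHom_apply F]
  exact congrArg _ ((mem_fixedField_iff _ _).mp hx _ ⟨φ, rfl⟩)

/-- The compositum of `L` with the relative algebraic closure of `F` in a normal extension `E / L`
is normal over `L`. -/
theorem normal_adjoin_algebraicClosure [Normal L E] :
    Normal L (adjoin L (algebraicClosure F E : Set E)) := by
  refine normal_iff_forall_map_le.mpr fun σ ↦ ?_
  rw [adjoin_map]
  refine adjoin.mono _ _ _ ?_
  rintro _ ⟨x, hx, rfl⟩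
  exact (map_mem_algebraicClosure_iff (σ.restrictScalars F)).mpr hx

end IntermediateField

/-- For a regular extension `K/k` in characteristic zero (i.e. `k` is
relatively algebraically closed in `K`), with `K̄` an algebraic closure of `K`,
`k̄ = integralClosure k K̄` the algebraic closure of `k` inside `K̄`, and
`K·k̄ = IntermediateField.adjoin K k̄` the compositum inside `K̄`, the extension
`K·k̄ / K` is Galois and restriction gives a group isomorphism
`Gal(K·k̄/K) ≃ Gal(k̄/k)`. -/
theorem stmt2 (k K Kbar : Type*) [Field k] [Field K] [Field Kbar] [CharZero k]
    [Algebra k K] [Algebra K Kbar] [Algebra k Kbar] [IsScalarTower k K Kbar]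
    [IsAlgClosure K Kbar]
    (hreg : ∀ x : K, IsAlgebraic k x → x ∈ (algebraMap k K).range) :
    IsGalois K (IntermediateField.adjoin K
        ((integralClosure k Kbar : Subalgebra k Kbar) : Set Kbar)) ∧
    ∃ res : ((IntermediateField.adjoin K
          ((integralClosure k Kbar : Subalgebra k Kbar) : Set Kbar)) ≃ₐ[K]
        (IntermediateField.adjoin K
          ((integralClosure k Kbar : Subalgebra k Kbar) : Set Kbar))) ≃*
        ((integralClosure k Kbar) ≃ₐ[k] (integralClosure k Kbar)),
      ∀ σ (x : Kbar) (hx : x ∈ integralClosure k Kbar)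
        (hx' : x ∈ IntermediateField.adjoin K
          ((integralClosure k Kbar : Subalgebra k Kbar) : Set Kbar)),
        ((res σ) ⟨x, hx⟩ : Kbar) = (σ ⟨x, hx'⟩ : Kbar) := by
  have : CharZero K := charZero_of_injective_algebraMap (algebraMap k K).injective
  have : IsAlgClosed Kbar := IsAlgClosure.isAlgClosed K
  let L := algebraicClosure k Kbar
  let M := IntermediateField.adjoin K (L : Set Kbar)
  have hnormal : Normal K M := IntermediateField.normal_adjoin_algebraicClosure k K Kbar
  have hgal : IsGalois K M := ⟨⟩
  refine ⟨hgal, ?_⟩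
  have hLM (x : L) : (x : Kbar) ∈ M := IntermediateField.subset_adjoin K _ x.2
  let : Algebra L M := ((algebraMap L Kbar).codRestrict M hLM).toAlgebra
  have : IsScalarTower k L M := .of_algebraMap_eq fun _ ↦ rfl
  let res := IntermediateField.restrictRestrictAlgEquivMapHom k L K M
  have hres (σ : Gal(M/K)) (x : L) : (res σ x : Kbar) = σ ⟨x, hLM x⟩ :=
    congrArg Subtype.val
      (IntermediateField.algebraMap_restrictRestrictAlgEquivMapHom_apply k L K M σ x)
  have hinj : Function.Injective res := by
    intro σ τ hστ
    have : (σ : M →ₐ[K] M) = τ := by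
      refine IntermediateField.adjoin_algHom_ext K fun x hx ↦ Subtype.ext ?_
      have h : (res σ ⟨x, hx⟩ : Kbar) = res τ ⟨x, hx⟩ := by rw [hστ]
      rwa [hres, hres] at h
    exact AlgEquiv.coe_toAlgHom_injective this
  have hsurj : Function.Surjective res := by
    refine IntermediateField.restrictRestrictAlgEquivMapHom_surjective_of_isGalois k L K M ?_
    rintro x ⟨y, hy⟩
    have hy' : algebraMap K Kbar y = x := congrArg Subtype.val hy
    obtain ⟨z, rfl⟩ := hreg y <| (isAlgebraic_algebraMap_iff (algebraMap K Kbar).injective).mp <|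
      hy' ▸ mem_algebraicClosure_iff.mp x.2
    exact ⟨z, Subtype.ext ((IsScalarTower.algebraMap_apply k K Kbar z).trans hy')⟩
  exact ⟨MulEquiv.ofBijective res ⟨hinj, hsurj⟩, fun σ x hx _ ↦ hres σ ⟨x, hx⟩⟩
end

section
/- Let k ⊆ K be a field extension of characteristic 0 such that k is relatively algebraically closed in K. Then for every algebraic field extension L/k, the tensor product K ⊗_k L is a field. -/
open scoped TensorProduct

open Polynomial in
/-- If `k` is integrally closed in `K`, the minimal polynomial over `k` of an integral element
remains its minimal polynomial over `K`. -/
theorem minpoly_eq_map_of_isIntegrallyClosedIn {k K M : Type*} [Field k] [Field K] [Field M]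
    [Algebra k K] [Algebra k M] [Algebra K M] [IsScalarTower k K M] [IsIntegrallyClosedIn k K]
    {x : M} (hx : IsIntegral k x) :
    minpoly K x = (minpoly k x).map (algebraMap k K) := by
  have hmonic : (minpoly K x).Monic := minpoly.monic hx.tower_top
  have hdvd : minpoly K x ∣ (minpoly k x).map (algebraMap k K) :=
    minpoly.dvd_map_of_isScalarTower k K x
  have hlifts : minpoly K x ∈ lifts (algebraMap k K) :=
    (lifts_iff_coeff_lifts _).2 fun i ↦ IsIntegrallyClosedIn.algebraMap_eq_of_integral
      (isIntegral_coeff_of_dvd _ _ (minpoly.monic hx) hmonic hdvd i)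
  obtain ⟨q, hq⟩ := (mem_lifts _).1 hlifts
  have hqx : aeval x q = 0 := by
    rw [← aeval_map_algebraMap K, hq, minpoly.aeval]
  have hdvd' : (minpoly k x).map (algebraMap k K) ∣ minpoly K x :=
    hq ▸ Polynomial.map_dvd _ (minpoly.dvd k x hqx)
  exact eq_of_monic_of_associated hmonic ((minpoly.monic hx).map _)
    (associated_of_dvd_dvd hdvd hdvd')

open IntermediateField in
/-- If `k` is integrally closed in an intermediate field `A`, then `A` is linearly disjoint from
every simple algebraic extension of `k`. -/
theorem IntermediateField.linearDisjoint_adjoin_simple_of_isIntegrallyClosedIn {k M : Type*}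
    [Field k] [Field M] [Algebra k M] (A : IntermediateField k M) [IsIntegrallyClosedIn k A]
    {x : M} (hx : IsIntegral k x) : A.LinearDisjoint k⟮x⟯ := by
  refine .of_basis_right (adjoin.powerBasis hx).basis ?_
  have hdeg : (adjoin.powerBasis hx).dim = (minpoly A x).natDegree := by
    rw [minpoly_eq_map_of_isIntegrallyClosedIn hx, Polynomial.natDegree_map, adjoin.powerBasis_dim]
  have hbasis : k⟮x⟯.val ∘ (adjoin.powerBasis hx).basis =
      (fun i : Fin (minpoly A x).natDegree ↦ x ^ (i : ℕ)) ∘ finCongr hdeg := by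
    ext i
    rw [Function.comp_apply, PowerBasis.basis_eq_pow, map_pow, adjoin.powerBasis_gen]
    rfl
  rw [hbasis]
  exact (linearIndependent_pow (K := A) x).comp _ (finCongr hdeg).injective

open IntermediateField in
/-- If `k` is integrally closed in an intermediate field `A`, then `A` is linearly disjoint from
every separable algebraic extension of `k`. -/
theorem IntermediateField.linearDisjoint_of_isIntegrallyClosedIn_of_isSeparable {k M : Type*}
    [Field k] [Field M] [Algebra k M] (A B : IntermediateField k M) [IsIntegrallyClosedIn k A]
    [Algebra.IsSeparable k B] : A.LinearDisjoint B := by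
  rw [linearDisjoint_iff']
  have : Algebra.IsIntegral k B.toSubalgebra := inferInstanceAs (Algebra.IsIntegral k B)
  refine Subalgebra.LinearDisjoint.of_linearDisjoint_finite_right _ _ fun B' hB' _ ↦ ?_
  let E : IntermediateField k M :=
    B'.toIntermediateField' (isField_of_isIntegral_of_isField' (Field.toIsField k))
  have : FiniteDimensional k E := ‹Module.Finite k B'›
  have hEB : E ≤ B := hB'
  have : Algebra.IsSeparable k E := Algebra.IsSeparable.of_algHom k B (inclusion hEB)
  obtain ⟨x, hx⟩ := Field.exists_primitive_element k E
  have hE : k⟮(x : M)⟯ = E := by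
    rw [← lift_adjoin_simple, hx, lift_top]
  have h := A.linearDisjoint_adjoin_simple_of_isIntegrallyClosedIn
    (x := (x : M)) (Algebra.IsIntegral.isIntegral x).algebraMap
  rw [hE] at h
  exact linearDisjoint_iff'.1 h

/-- For a regular extension `K/k` in characteristic zero (i.e. `k` is
relatively algebraically closed in `K`) and any algebraic field extension `L/k`,
the tensor product `K ⊗_k L` is a field. -/
theorem stmt3 (k K : Type*) [Field k] [Field K] [CharZero k] [Algebra k K]
    (hreg : ∀ x : K, IsAlgebraic k x → x ∈ (algebraMap k K).range)
    (L : Type*) [Field L] [Algebra k L] [Algebra.IsAlgebraic k L] :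
    IsField (K ⊗[k] L) := by
  refine IntermediateField.LinearDisjoint.isField_of_forall k K L fun M _ _ fa fb ↦ ?_
  have : IsIntegrallyClosedIn k fa.fieldRange := by
    refine isIntegrallyClosedIn_iff.2 ⟨FaithfulSMul.algebraMap_injective _ _, fun {y} hy ↦ ?_⟩
    obtain ⟨_, x, rfl⟩ := y
    have hx : IsIntegral k x :=
      (isIntegral_algHom_iff fa fa.injective).1 (hy.map fa.fieldRange.val)
    obtain ⟨c, rfl⟩ := hreg x hx.isAlgebraic
    exact ⟨c, Subtype.ext (fa.commutes c).symm⟩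
  have : Algebra.IsAlgebraic k fb.fieldRange :=
    (AlgEquiv.ofInjectiveField fb).isAlgebraic
  exact fa.fieldRange.linearDisjoint_of_isIntegrallyClosedIn_of_isSeparable fb.fieldRange
end
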